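/- G4CK is sound and complete with respect to CK: for every finite multiset Γ and formula δ, ⊢_G4CK Γ ⇒ δ if and only if Γ ⊢_CK δ (where on the right Γ is read as the set of its elements). -/

import Mathlib

/-- Formulas of the modal language: φ ::= p | ⊥ | φ∧φ | φ∨φ | φ→φ | □φ | ◇φ. -/
inductive Form : Type
  | var : ℕ → Form
  | bot : Form
  | and : Form → Form → Form
  | or  : Form → Form → Form
  | imp : Form → Form → Form
  | box : Form → Form
  | dia : Form → Form
  deriving DecidableEq

/-- Helper for □⁻¹: remove an outer box. -/
def unboxF : Form → Option Form
  | Form.box φ => some φ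
  | _ => none

/-- □⁻¹Γ := {φ | □φ ∈ Γ}, as a multiset operation. -/
def boxInv (Γ : Multiset Form) : Multiset Form := Γ.filterMap unboxF

/-- ◇⁻¹Δ for a succedent Δ with at most one formula (modelled by `Option`). -/
def diaInv : Option Form → Option Form
  | some (Form.dia φ) => some φ
  | _ => none

/-- Provability in the sequent calculus G4CK: sequents Γ ⇒ δ with a
multiset antecedent and a single-formula succedent. -/
inductive G4CK : Multiset Form → Form → Prop
  | botL (Γ δ) : G4CK (Form.bot ::ₘ Γ) δ
  | idP (Γ n) : G4CK (Form.var n ::ₘ Γ) (Form.var n)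
  | andL (Γ φ ψ δ) : G4CK (φ ::ₘ ψ ::ₘ Γ) δ → G4CK (Form.and φ ψ ::ₘ Γ) δ
  | andR (Γ φ ψ) : G4CK Γ φ → G4CK Γ ψ → G4CK Γ (Form.and φ ψ)
  | orL (Γ φ ψ δ) : G4CK (φ ::ₘ Γ) δ → G4CK (ψ ::ₘ Γ) δ → G4CK (Form.or φ ψ ::ₘ Γ) δ
  | orR1 (Γ φ ψ) : G4CK Γ φ → G4CK Γ (Form.or φ ψ)
  | orR2 (Γ φ ψ) : G4CK Γ ψ → G4CK Γ (Form.or φ ψ)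
  | impR (Γ φ ψ) : G4CK (φ ::ₘ Γ) ψ → G4CK Γ (Form.imp φ ψ)
  | andImpL (Γ φ ψ χ δ) :
      G4CK (Form.imp φ (Form.imp ψ χ) ::ₘ Γ) δ →
      G4CK (Form.imp (Form.and φ ψ) χ ::ₘ Γ) δ
  | orImpL (Γ φ ψ χ δ) :
      G4CK (Form.imp φ χ ::ₘ Form.imp ψ χ ::ₘ Γ) δ →
      G4CK (Form.imp (Form.or φ ψ) χ ::ₘ Γ) δ
  | pImpL (Γ n φ δ) :
      G4CK (Form.var n ::ₘ φ ::ₘ Γ) δ →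
      G4CK (Form.var n ::ₘ Form.imp (Form.var n) φ ::ₘ Γ) δ
  | impImpL (Γ φ ψ χ δ) :
      G4CK (Form.imp ψ χ ::ₘ Γ) (Form.imp φ ψ) → G4CK (χ ::ₘ Γ) δ →
      G4CK (Form.imp (Form.imp φ ψ) χ ::ₘ Γ) δ
  | boxR (Γ φ) : G4CK (boxInv Γ) φ → G4CK Γ (Form.box φ)
  | boxImpL (Γ φ ψ δ) :
      G4CK (boxInv Γ) φ → G4CK (ψ ::ₘ Γ) δ →
      G4CK (Form.imp (Form.box φ) ψ ::ₘ Γ) δ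
  | diaImpL (Γ γ φ ψ δ) :
      G4CK (γ ::ₘ boxInv Γ) φ → G4CK (ψ ::ₘ Form.dia γ ::ₘ Γ) δ →
      G4CK (Form.imp (Form.dia φ) ψ ::ₘ Form.dia γ ::ₘ Γ) δ
  | diaL (Γ φ ψ) : G4CK (φ ::ₘ boxInv Γ) ψ → G4CK (Form.dia φ ::ₘ Γ) (Form.dia ψ)

/-- Provability in the sequent calculus G4WK: sequents Γ ⇒ Δ with a
multiset antecedent and a succedent with at most one formula (`Option Form`). -/
inductive G4WK : Multiset Form → Option Form → Prop
  | botL (Γ Δ) : G4WK (Form.bot ::ₘ Γ) Δ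
  | idP (Γ n) : G4WK (Form.var n ::ₘ Γ) (some (Form.var n))
  | andL (Γ φ ψ Δ) : G4WK (φ ::ₘ ψ ::ₘ Γ) Δ → G4WK (Form.and φ ψ ::ₘ Γ) Δ
  | andR (Γ φ ψ) : G4WK Γ (some φ) → G4WK Γ (some ψ) → G4WK Γ (some (Form.and φ ψ))
  | orL (Γ φ ψ Δ) : G4WK (φ ::ₘ Γ) Δ → G4WK (ψ ::ₘ Γ) Δ → G4WK (Form.or φ ψ ::ₘ Γ) Δ
  | orR1 (Γ φ ψ) : G4WK Γ (some φ) → G4WK Γ (some (Form.or φ ψ))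
  | orR2 (Γ φ ψ) : G4WK Γ (some ψ) → G4WK Γ (some (Form.or φ ψ))
  | impR (Γ φ ψ) : G4WK (φ ::ₘ Γ) (some ψ) → G4WK Γ (some (Form.imp φ ψ))
  | andImpL (Γ φ ψ χ Δ) :
      G4WK (Form.imp φ (Form.imp ψ χ) ::ₘ Γ) Δ →
      G4WK (Form.imp (Form.and φ ψ) χ ::ₘ Γ) Δ
  | orImpL (Γ φ ψ χ Δ) :
      G4WK (Form.imp φ χ ::ₘ Form.imp ψ χ ::ₘ Γ) Δ →
      G4WK (Form.imp (Form.or φ ψ) χ ::ₘ Γ) Δ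
  | pImpL (Γ n φ Δ) :
      G4WK (Form.var n ::ₘ φ ::ₘ Γ) Δ →
      G4WK (Form.var n ::ₘ Form.imp (Form.var n) φ ::ₘ Γ) Δ
  | impImpL (Γ φ ψ χ Δ) :
      G4WK (Form.imp ψ χ ::ₘ Γ) (some (Form.imp φ ψ)) → G4WK (χ ::ₘ Γ) Δ →
      G4WK (Form.imp (Form.imp φ ψ) χ ::ₘ Γ) Δ
  | boxR (Γ φ) : G4WK (boxInv Γ) (some φ) → G4WK Γ (some (Form.box φ))
  | boxImpL (Γ φ ψ Δ) :
      G4WK (boxInv Γ) (some φ) → G4WK (ψ ::ₘ Γ) Δ →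
      G4WK (Form.imp (Form.box φ) ψ ::ₘ Γ) Δ
  | diaImpL (Γ γ φ ψ Δ) :
      G4WK (γ ::ₘ boxInv Γ) (some φ) → G4WK (ψ ::ₘ Form.dia γ ::ₘ Γ) Δ →
      G4WK (Form.imp (Form.dia φ) ψ ::ₘ Form.dia γ ::ₘ Γ) Δ
  | diaL' (Γ φ Δ) : G4WK (φ ::ₘ boxInv Γ) (diaInv Δ) → G4WK (Form.dia φ ::ₘ Γ) Δ

/-- Axiom schemes of the generalised Hilbert calculus CKH:
intuitionistic axioms A1–A9 together with K_□ and K_◇. -/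
inductive CKAx : Form → Prop
  | a1 (φ ψ : Form) : CKAx (φ.imp (ψ.imp φ))
  | a2 (φ ψ χ : Form) : CKAx ((φ.imp (ψ.imp χ)).imp ((φ.imp ψ).imp (φ.imp χ)))
  | a3 (φ ψ : Form) : CKAx (φ.imp (φ.or ψ))
  | a4 (φ ψ : Form) : CKAx (ψ.imp (φ.or ψ))
  | a5 (φ ψ χ : Form) : CKAx ((φ.imp χ).imp ((ψ.imp χ).imp ((φ.or ψ).imp χ)))
  | a6 (φ ψ : Form) : CKAx ((φ.and ψ).imp φ)
  | a7 (φ ψ : Form) : CKAx ((φ.and ψ).imp ψ)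
  | a8 (φ ψ χ : Form) : CKAx ((φ.imp ψ).imp ((φ.imp χ).imp (φ.imp (ψ.and χ))))
  | a9 (φ : Form) : CKAx (Form.bot.imp φ)
  | kbox (φ ψ : Form) : CKAx ((φ.imp ψ).box.imp (φ.box.imp ψ.box))
  | kdia (φ ψ : Form) : CKAx ((φ.imp ψ).box.imp (φ.dia.imp ψ.dia))

/-- Axiom schemes of WKH: those of CKH together with N : ¬◇⊥. -/
inductive WKAx : Form → Prop
  | ck {φ : Form} : CKAx φ → WKAx φ
  | n : WKAx (Form.bot.dia.imp Form.bot)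

/-- Derivability Γ ⊢ φ in the generalised Hilbert calculus CKH. -/
inductive CKH : Set Form → Form → Prop
  | ax {Γ : Set Form} {φ : Form} : CKAx φ → CKH Γ φ
  | el {Γ : Set Form} {φ : Form} : φ ∈ Γ → CKH Γ φ
  | mp {Γ : Set Form} {φ ψ : Form} : CKH Γ φ → CKH Γ (φ.imp ψ) → CKH Γ ψ
  | nec {Γ : Set Form} {φ : Form} : CKH ∅ φ → CKH Γ φ.box

/-- Derivability Γ ⊢ φ in the generalised Hilbert calculus WKH. -/
inductive WKH : Set Form → Form → Prop
  | ax {Γ : Set Form} {φ : Form} : WKAx φ → WKH Γ φ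
  | el {Γ : Set Form} {φ : Form} : φ ∈ Γ → WKH Γ φ
  | mp {Γ : Set Form} {φ ψ : Form} : WKH Γ φ → WKH Γ (φ.imp ψ) → WKH Γ ψ
  | nec {Γ : Set Form} {φ : Form} : WKH ∅ φ → WKH Γ φ.box

/-- The set of propositional variables occurring in a formula. -/
def vars : Form → Set ℕ
  | .var n => {n}
  | .bot => ∅
  | .and φ ψ => vars φ ∪ vars ψ
  | .or φ ψ => vars φ ∪ vars ψ
  | .imp φ ψ => vars φ ∪ vars ψ
  | .box φ => vars φ
  | .dia φ => vars φ

/-- Variables occurring in a multiset of formulas. -/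
def varsM (Γ : Multiset Form) : Set ℕ := {n | ∃ φ ∈ Γ, n ∈ vars φ}

/-- Variables occurring in a succedent with at most one formula. -/
def varsO : Option Form → Set ℕ
  | none => ∅
  | some φ => vars φ

theorem mem_boxInv {Γ : Multiset Form} {φ : Form} : φ ∈ boxInv Γ ↔ φ.box ∈ Γ := by
  simp only [boxInv, Multiset.mem_filterMap]
  constructor
  · rintro ⟨a, ha, h⟩
    cases a <;> simp_all [unboxF]
  · exact fun h => ⟨_, h, rfl⟩

theorem boxInv_cons_imp (φ ψ : Form) (Γ : Multiset Form) :
    boxInv (φ.imp ψ ::ₘ Γ) = boxInv Γ :=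
  Multiset.filterMap_cons_none _ _ rfl

theorem boxInv_cons_dia (φ : Form) (Γ : Multiset Form) : boxInv (φ.dia ::ₘ Γ) = boxInv Γ :=
  Multiset.filterMap_cons_none _ _ rfl

namespace CKH

variable {S T : Set Form} {Γ : Multiset Form} {φ ψ χ : Form}

/-- Derivations compose: every assumption may be replaced by a derivation of it. -/
theorem cut (h : CKH S φ) (hT : ∀ ψ ∈ S, CKH T ψ) : CKH T φ := by
  induction h with
  | ax h => exact ax h
  | el h => exact hT _ h
  | mp _ _ ih₁ ih₂ => exact mp (ih₁ hT) (ih₂ hT)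
  | nec h _ => exact nec h

theorem mono (h : CKH S φ) (hST : S ⊆ T) : CKH T φ := h.cut fun _ hψ => el (hST hψ)

theorem imp_self (S : Set Form) (φ : Form) : CKH S (φ.imp φ) :=
  mp (ax (.a1 φ φ)) (mp (ax (.a1 φ (φ.imp φ))) (ax (.a2 _ _ _)))

theorem imp_intro (ψ : Form) (h : CKH S φ) : CKH S (ψ.imp φ) := mp h (ax (.a1 _ _))

theorem deduction (h : CKH (insert φ S) ψ) : CKH S (φ.imp ψ) := by
  generalize hT : insert φ S = T at h
  induction h with
  | ax h => exact imp_intro _ (ax h)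
  | el h =>
    subst hT
    rcases h with rfl | h
    · exact imp_self _ _
    · exact imp_intro _ (el h)
  | mp _ _ ih₁ ih₂ => exact mp (ih₁ hT) (mp (ih₂ hT) (ax (.a2 _ _ _)))
  | nec h _ => exact imp_intro _ (nec h)

theorem cons_iff : CKH {x | x ∈ φ ::ₘ Γ} ψ ↔ CKH {x | x ∈ Γ} (φ.imp ψ) := by
  constructor
  · intro h
    exact deduction (h.mono fun x hx => by simpa using hx)
  · intro h
    exact mp (el (by simp)) (h.mono fun x hx => by simp_all)

theorem imp_trans (h₁ : CKH S (φ.imp ψ)) (h₂ : CKH S (ψ.imp χ)) : CKH S (φ.imp χ) :=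
  mp h₁ (mp (imp_intro _ h₂) (ax (.a2 _ _ _)))

theorem and_intro (h₁ : CKH S φ) (h₂ : CKH S ψ) : CKH S (φ.and ψ) :=
  mp h₁ (mp (imp_intro _ h₂) (mp (imp_self _ _) (ax (.a8 _ _ _))))

theorem and_left (h : CKH S (φ.and ψ)) : CKH S φ := mp h (ax (.a6 _ _))

theorem and_right (h : CKH S (φ.and ψ)) : CKH S ψ := mp h (ax (.a7 _ _))

theorem or_inl (ψ : Form) (h : CKH S φ) : CKH S (φ.or ψ) := mp h (ax (.a3 _ _))

theorem or_inr (φ : Form) (h : CKH S ψ) : CKH S (φ.or ψ) := mp h (ax (.a4 _ _))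

theorem or_elim (h₁ : CKH S (φ.imp χ)) (h₂ : CKH S (ψ.imp χ)) : CKH S ((φ.or ψ).imp χ) :=
  mp h₂ (mp h₁ (ax (.a5 _ _ _)))

/-- Replacing the head of an antecedent by formulas derivable from the new antecedent. -/
theorem cons_cut {a : Form} {Δ : Multiset Form} (h : CKH {x | x ∈ Δ} χ)
    (hΔ : ∀ x ∈ Δ, x ∉ Γ → CKH {x | x ∈ a ::ₘ Γ} x) : CKH {x | x ∈ a ::ₘ Γ} χ := by
  refine h.cut fun x hx => ?_
  by_cases hxΓ : x ∈ Γ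
  · exact el (by simp [hxΓ])
  · exact hΔ x hx hxΓ

/-- An implication in the antecedent may be replaced by its conclusion. -/
theorem cons_of_cons_imp (h : CKH {x | x ∈ φ.imp ψ ::ₘ Γ} χ) : CKH {x | x ∈ ψ ::ₘ Γ} χ :=
  cons_cut h fun x hx hxΓ => by
    simp only [Multiset.mem_cons, hxΓ, or_false] at hx
    subst hx
    exact imp_intro _ (el (by simp))

/-- If `(φ → ψ) → χ` is used to derive `φ → ψ`, then `ψ → χ` is enough. -/
theorem cons_imp_of_cons_imp_imp (h : CKH {x | x ∈ (φ.imp ψ).imp χ ::ₘ Γ} (φ.imp ψ)) :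
    CKH {x | x ∈ ψ.imp χ ::ₘ Γ} (φ.imp ψ) := by
  refine deduction (mp (φ := φ) (el (by simp)) (h.cut fun x hx => ?_))
  rcases Multiset.mem_cons.1 hx with rfl | hx
  · refine deduction (mp (φ := ψ) ?_ (el (by simp)))
    exact mp (φ := φ) (el (by simp)) (el (by simp))
  · exact el (by simp [hx])

theorem box_of_forall_box (h : CKH S φ) (hT : ∀ ψ ∈ S, CKH T ψ.box) : CKH T φ.box := by
  induction h with
  | ax h => exact nec (ax h)
  | el h => exact hT _ h
  | mp _ _ ih₁ ih₂ => exact mp (ih₁ hT) (mp (ih₂ hT) (ax (.kbox _ _)))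
  | nec h _ => exact nec (nec h)

theorem box_of_boxInv (h : CKH {x | x ∈ boxInv Γ} φ) : CKH {x | x ∈ Γ} φ.box :=
  h.box_of_forall_box fun _ hψ => el (mem_boxInv.1 hψ)

theorem dia_of_boxInv (hφ : φ.dia ∈ Γ) (h : CKH {x | x ∈ φ ::ₘ boxInv Γ} ψ) :
    CKH {x | x ∈ Γ} ψ.dia :=
  mp (el hφ) (mp (box_of_boxInv (cons_iff.1 h)) (ax (.kdia _ _)))

end CKH

theorem G4CK.sound {Γ : Multiset Form} {δ : Form} (h : G4CK Γ δ) : CKH {x | x ∈ Γ} δ := by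
  induction h with
  | botL Γ δ => exact .mp (.el (by simp)) (.ax (.a9 _))
  | idP Γ n => exact .el (by simp)
  | andL Γ φ ψ δ _ ih =>
    have h : CKH {x | x ∈ φ.and ψ ::ₘ Γ} (φ.and ψ) := .el (by simp)
    refine ih.cons_cut fun x hx hxΓ => ?_
    simp only [Multiset.mem_cons, hxΓ, or_false] at hx
    rcases hx with rfl | rfl
    exacts [h.and_left, h.and_right]
  | andR Γ φ ψ _ _ ih₁ ih₂ => exact ih₁.and_intro ih₂
  | orL Γ φ ψ δ _ _ ih₁ ih₂ =>
    exact CKH.cons_iff.2 (.or_elim (CKH.cons_iff.1 ih₁) (CKH.cons_iff.1 ih₂))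
  | orR1 Γ φ ψ _ ih => exact ih.or_inl _
  | orR2 Γ φ ψ _ ih => exact ih.or_inr _
  | impR Γ φ ψ _ ih => exact CKH.cons_iff.1 ih
  | andImpL Γ φ ψ χ δ _ ih =>
    refine ih.cons_cut fun x hx hxΓ => ?_
    simp only [Multiset.mem_cons, hxΓ, or_false] at hx
    subst hx
    refine .deduction (.deduction (.mp (φ := φ.and ψ) ?_ (.el (by simp))))
    exact .and_intro (.el (by simp)) (.el (by simp))
  | orImpL Γ φ ψ χ δ _ ih =>
    have h : CKH {x | x ∈ (φ.or ψ).imp χ ::ₘ Γ} ((φ.or ψ).imp χ) := .el (by simp)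
    refine ih.cons_cut fun x hx hxΓ => ?_
    simp only [Multiset.mem_cons, hxΓ, or_false] at hx
    rcases hx with rfl | rfl
    exacts [.imp_trans (.ax (.a3 _ _)) h, .imp_trans (.ax (.a4 _ _)) h]
  | pImpL Γ n φ δ _ ih =>
    refine ih.cut fun x hx => ?_
    simp only [Set.mem_ofPred_eq, Multiset.mem_cons] at hx
    rcases hx with rfl | rfl | hx
    · exact .el (by simp)
    · exact .mp (φ := .var n) (.el (by simp)) (.el (by simp))
    · exact .el (by simp [hx])
  | impImpL Γ φ ψ χ δ _ _ ih₁ ih₂ =>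
    refine ih₂.cons_cut fun x hx hxΓ => ?_
    simp only [Multiset.mem_cons, hxΓ, or_false] at hx
    subst hx
    refine .mp (φ := φ.imp ψ) (ih₁.cons_cut fun y hy hyΓ => ?_) (.el (by simp))
    simp only [Multiset.mem_cons, hyΓ, or_false] at hy
    subst hy
    exact .imp_trans (.ax (.a1 ψ φ)) (.el (by simp))
  | boxR Γ φ _ ih => exact ih.box_of_boxInv
  | boxImpL Γ φ ψ δ _ _ ih₁ ih₂ =>
    refine ih₂.cons_cut fun x hx hxΓ => ?_
    simp only [Multiset.mem_cons, hxΓ, or_false] at hx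
    subst hx
    exact .mp (ih₁.box_of_boxInv.mono fun y hy => by simp_all) (.el (by simp))
  | diaImpL Γ γ φ ψ δ _ _ ih₁ ih₂ =>
    refine ih₂.cons_cut fun x hx hxΓ => ?_
    simp only [Multiset.mem_cons] at hx hxΓ
    obtain rfl : x = ψ := by tauto
    refine .mp (CKH.dia_of_boxInv (φ := γ) (ψ := φ) (by simp) ?_) (.el (by simp))
    rwa [boxInv_cons_imp, boxInv_cons_dia]
  | diaL Γ φ ψ _ ih =>
    refine CKH.dia_of_boxInv (φ := φ) (by simp) ?_
    rwa [boxInv_cons_dia]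

/-- An Aczel slash for CK: a formula is slashed by `Γ` when it is derivable from `Γ` by
introduction rules, where modal formulas are introduced by derivability from `□⁻¹Γ`. -/
def Slash (Γ : Multiset Form) : Form → Prop
  | .var n => .var n ∈ Γ
  | .bot => False
  | .and φ ψ => Slash Γ φ ∧ Slash Γ ψ
  | .or φ ψ => Slash Γ φ ∨ Slash Γ ψ
  | .imp φ ψ => CKH {x | x ∈ Γ} (φ.imp ψ) ∧ (Slash Γ φ → Slash Γ ψ)
  | .box φ => CKH {x | x ∈ boxInv Γ} φ
  | .dia φ => ∃ γ : Form, γ.dia ∈ Γ ∧ CKH {x | x ∈ γ ::ₘ boxInv Γ} φ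

namespace Slash

variable {Γ : Multiset Form} {φ : Form}

theorem ckh (h : Slash Γ φ) : CKH {x | x ∈ Γ} φ := by
  induction φ with
  | var n => exact .el h
  | bot => exact h.elim
  | and φ ψ ih₁ ih₂ => exact (ih₁ h.1).and_intro (ih₂ h.2)
  | or φ ψ ih₁ ih₂ => exact h.elim (fun h => (ih₁ h).or_inl _) (fun h => (ih₂ h).or_inr _)
  | imp φ ψ => exact h.1
  | box φ => exact CKH.box_of_boxInv h
  | dia φ =>
    obtain ⟨γ, hγ, h⟩ := h
    exact CKH.dia_of_boxInv hγ h

theorem of_ax (h : CKAx φ) : Slash Γ φ := by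
  cases h with
  | a1 φ ψ => exact ⟨.ax (.a1 _ _), fun h => ⟨h.ckh.imp_intro _, fun _ => h⟩⟩
  | a2 φ ψ χ =>
    exact ⟨.ax (.a2 _ _ _), fun h₁ => ⟨.mp h₁.ckh (.ax (.a2 _ _ _)), fun h₂ =>
      ⟨.mp h₂.ckh (.mp h₁.ckh (.ax (.a2 _ _ _))), fun h => (h₁.2 h).2 (h₂.2 h)⟩⟩⟩
  | a3 φ ψ => exact ⟨.ax (.a3 _ _), Or.inl⟩
  | a4 φ ψ => exact ⟨.ax (.a4 _ _), Or.inr⟩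
  | a5 φ ψ χ =>
    exact ⟨.ax (.a5 _ _ _), fun h₁ => ⟨.mp h₁.ckh (.ax (.a5 _ _ _)), fun h₂ =>
      ⟨h₁.ckh.or_elim h₂.ckh, fun h => h.elim h₁.2 h₂.2⟩⟩⟩
  | a6 φ ψ => exact ⟨.ax (.a6 _ _), And.left⟩
  | a7 φ ψ => exact ⟨.ax (.a7 _ _), And.right⟩
  | a8 φ ψ χ =>
    exact ⟨.ax (.a8 _ _ _), fun h₁ => ⟨.mp h₁.ckh (.ax (.a8 _ _ _)), fun h₂ =>
      ⟨.mp h₂.ckh (.mp h₁.ckh (.ax (.a8 _ _ _))), fun h => ⟨h₁.2 h, h₂.2 h⟩⟩⟩⟩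
  | a9 φ => exact ⟨.ax (.a9 _), False.elim⟩
  | kbox φ ψ =>
    refine ⟨.ax (.kbox _ _), fun h₁ => ⟨.mp h₁.ckh (.ax (.kbox _ _)), fun h₂ => ?_⟩⟩
    exact CKH.mp (φ := φ) h₂ h₁
  | kdia φ ψ =>
    refine ⟨.ax (.kdia _ _), fun h₁ => ⟨.mp h₁.ckh (.ax (.kdia _ _)), ?_⟩⟩
    rintro ⟨γ, hγ, h₂⟩
    exact ⟨γ, hγ, .mp h₂ (CKH.mono (φ := φ.imp ψ) h₁ fun x hx => by simp_all)⟩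

/-- If `Γ` slashes all its members, then it slashes all its consequences. -/
theorem of_ckh (hΓ : ∀ γ ∈ Γ, Slash Γ γ) (h : CKH {x | x ∈ Γ} φ) : Slash Γ φ := by
  generalize hS : {x | x ∈ Γ} = S at h
  induction h with
  | ax h => exact of_ax h
  | el h =>
    subst hS
    exact hΓ _ h
  | mp _ _ ih₁ ih₂ => exact (ih₂ hS).2 (ih₁ hS)
  | nec h _ => exact CKH.mono h (Set.empty_subset _)

end Slash

/-- Dyckhoff's weight of a formula. -/
def Form.weight : Form → ℕ
  | .var _ => 1
  | .bot => 1
  | .and φ ψ => φ.weight + ψ.weight + 2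
  | .or φ ψ => φ.weight + ψ.weight + 1
  | .imp φ ψ => φ.weight + ψ.weight + 1
  | .box φ => φ.weight + 1
  | .dia φ => φ.weight + 1

theorem Form.weight_pos (φ : Form) : 0 < φ.weight := by
  cases φ <;> simp [Form.weight]

/-- The size of an antecedent, arranged so that replacing a formula by two formulas of smaller
weight decreases it. -/
def antecedentSize (Γ : Multiset Form) : ℕ := (Γ.map fun φ => 3 ^ φ.weight).sum

@[simp]
theorem antecedentSize_cons (φ : Form) (Γ : Multiset Form) :
    antecedentSize (φ ::ₘ Γ) = 3 ^ φ.weight + antecedentSize Γ := by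
  simp [antecedentSize]

theorem antecedentSize_boxInv_le (Γ : Multiset Form) :
    antecedentSize (boxInv Γ) ≤ antecedentSize Γ := by
  induction Γ using Multiset.induction with
  | empty => simp [boxInv]
  | cons a Γ ih =>
    cases h : unboxF a with
    | none =>
      rw [boxInv, Multiset.filterMap_cons_none _ _ h, antecedentSize_cons]
      exact ih.trans (Nat.le_add_left _ _)
    | some b =>
      rw [boxInv, Multiset.filterMap_cons_some _ _ _ h, antecedentSize_cons, antecedentSize_cons]
      have hab : b.weight ≤ a.weight := by
        cases a <;> simp_all [unboxF, Form.weight]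
      exact Nat.add_le_add (Nat.pow_le_pow_right (by norm_num) hab) ih

theorem three_pow_lt {a c : ℕ} (h : a < c) : 3 ^ a < 3 ^ c :=
  Nat.pow_lt_pow_right (by norm_num) h

theorem three_pow_add_lt {a b c : ℕ} (ha : a < c) (hb : b < c) : 3 ^ a + 3 ^ b < 3 ^ c := by
  obtain ⟨c, rfl⟩ : ∃ d, c = d + 1 := ⟨c - 1, by omega⟩
  have h₁ : 3 ^ a ≤ 3 ^ c := Nat.pow_le_pow_right (by norm_num) (by omega)
  have h₂ : 3 ^ b ≤ 3 ^ c := Nat.pow_le_pow_right (by norm_num) (by omega)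
  have h₃ : 0 < 3 ^ c := by positivity
  rw [pow_succ]
  omega

/-- The size of a sequent. -/
def sequentSize (Γ : Multiset Form) (δ : Form) : ℕ := antecedentSize Γ + 3 ^ δ.weight

theorem sequentSize_cons_lt {a b : Form} (h : b.weight < a.weight) (Γ : Multiset Form)
    (δ : Form) : sequentSize (b ::ₘ Γ) δ < sequentSize (a ::ₘ Γ) δ := by
  have := three_pow_lt h
  simp only [sequentSize, antecedentSize_cons]
  omega

theorem sequentSize_cons_cons_lt {a b c : Form} (hb : b.weight < a.weight)
    (hc : c.weight < a.weight) (Γ : Multiset Form) (δ : Form) :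
    sequentSize (b ::ₘ c ::ₘ Γ) δ < sequentSize (a ::ₘ Γ) δ := by
  have := three_pow_add_lt hb hc
  simp only [sequentSize, antecedentSize_cons]
  omega

namespace G4CK

variable {Γ : Multiset Form} {δ : Form}

/-- The antecedents to which no left rule of proof search applies: no invertible left rule is
applicable, and for every other left implication rule the first premise is underivable. -/
structure Irreducible (Γ : Multiset Form) : Prop where
  bot_notMem : .bot ∉ Γ
  and_notMem (φ ψ : Form) : φ.and ψ ∉ Γ
  or_notMem (φ ψ : Form) : φ.or ψ ∉ Γ
  and_imp_notMem (φ ψ χ : Form) : (φ.and ψ).imp χ ∉ Γ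
  or_imp_notMem (φ ψ χ : Form) : (φ.or ψ).imp χ ∉ Γ
  var_notMem (n : ℕ) (φ : Form) (h : (Form.var n).imp φ ∈ Γ) : .var n ∉ Γ
  not_ckh_imp (φ ψ χ : Form) (h : (φ.imp ψ).imp χ ∈ Γ) : ¬CKH {x | x ∈ Γ} (φ.imp ψ)
  not_ckh_box (φ ψ : Form) (h : φ.box.imp ψ ∈ Γ) : ¬CKH {x | x ∈ boxInv Γ} φ
  not_ckh_dia (γ φ ψ : Form) (hγ : γ.dia ∈ Γ) (h : φ.dia.imp ψ ∈ Γ) :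
    ¬CKH {x | x ∈ γ ::ₘ boxInv Γ} φ

theorem Irreducible.slash (hΓ : Irreducible Γ) {γ : Form} (hγ : γ ∈ Γ) : Slash Γ γ := by
  match γ, hγ with
  | .var n, hγ => exact hγ
  | .bot, hγ => exact (hΓ.bot_notMem hγ).elim
  | .and φ ψ, hγ => exact (hΓ.and_notMem φ ψ hγ).elim
  | .or φ ψ, hγ => exact (hΓ.or_notMem φ ψ hγ).elim
  | .box φ, hγ => exact CKH.el (mem_boxInv.2 hγ)
  | .dia φ, hγ => exact ⟨φ, hγ, .el (by simp)⟩
  | .imp (.var n) ψ, hγ => exact ⟨.el hγ, fun h => (hΓ.var_notMem n ψ hγ h).elim⟩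
  | .imp .bot ψ, hγ => exact ⟨.el hγ, False.elim⟩
  | .imp (.and φ ψ) χ, hγ => exact (hΓ.and_imp_notMem φ ψ χ hγ).elim
  | .imp (.or φ ψ) χ, hγ => exact (hΓ.or_imp_notMem φ ψ χ hγ).elim
  | .imp (.imp φ ψ) χ, hγ => exact ⟨.el hγ, fun h => (hΓ.not_ckh_imp φ ψ χ hγ h.1).elim⟩
  | .imp (.box φ) ψ, hγ => exact ⟨.el hγ, fun h => (hΓ.not_ckh_box φ ψ hγ h).elim⟩
  | .imp (.dia φ) ψ, hγ =>
    exact ⟨.el hγ, fun ⟨γ, h, hφ⟩ => (hΓ.not_ckh_dia γ φ ψ h hγ hφ).elim⟩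

/-- A derivable sequent with an irreducible antecedent follows by a right rule or a modal rule
from smaller derivable sequents. -/
theorem of_ckh_of_irreducible
    (ih : ∀ Γ' δ', sequentSize Γ' δ' < sequentSize Γ δ → CKH {x | x ∈ Γ'} δ' → G4CK Γ' δ')
    (hΓ : Irreducible Γ) (h : CKH {x | x ∈ Γ} δ) : G4CK Γ δ := by
  have hs : Slash Γ δ := .of_ckh (fun _ => hΓ.slash) h
  have hbox := antecedentSize_boxInv_le Γ
  have right {δ' : Form} (hw : δ'.weight < δ.weight) (h' : CKH {x | x ∈ Γ} δ') : G4CK Γ δ' :=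
    ih _ _ (Nat.add_lt_add_left (three_pow_lt hw) _) h'
  cases δ with
  | var n =>
    obtain ⟨Γ, rfl⟩ := Multiset.exists_cons_of_mem hs
    exact idP Γ n
  | bot => exact hs.elim
  | and φ ψ =>
    exact andR _ _ _ (right (by simp only [Form.weight]; omega) h.and_left)
      (right (by simp only [Form.weight]; omega) h.and_right)
  | or φ ψ =>
    have hφ := φ.weight_pos
    have hψ := ψ.weight_pos
    rcases hs with hs | hs
    · exact orR1 _ _ _ (right (by simp only [Form.weight]; omega) hs.ckh)
    · exact orR2 _ _ _ (right (by simp only [Form.weight]; omega) hs.ckh)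
  | imp φ ψ =>
    refine impR _ _ _ (ih _ _ ?_ (CKH.cons_iff.2 h))
    have := three_pow_add_lt (a := φ.weight) (b := ψ.weight) (c := (φ.imp ψ).weight)
      (by simp only [Form.weight]; omega) (by simp only [Form.weight]; omega)
    simp only [sequentSize, antecedentSize_cons]
    omega
  | box φ =>
    refine boxR _ _ (ih _ _ ?_ hs)
    exact Nat.add_lt_add_of_le_of_lt hbox (three_pow_lt (Nat.lt_succ_self _))
  | dia φ =>
    obtain ⟨γ, hγ, hs⟩ := hs
    obtain ⟨Γ, rfl⟩ := Multiset.exists_cons_of_mem hγ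
    rw [boxInv_cons_dia] at hs
    refine diaL _ _ _ (ih _ _ ?_ hs)
    have := antecedentSize_boxInv_le Γ
    have := three_pow_lt (a := γ.weight) (c := γ.dia.weight) (Nat.lt_succ_self _)
    have := three_pow_lt (a := φ.weight) (c := φ.dia.weight) (Nat.lt_succ_self _)
    simp only [sequentSize, antecedentSize_cons]
    omega

/-- One step of proof search: derivable sequents are provable as soon as the smaller derivable
ones are. -/
theorem of_ckh_step
    (ih : ∀ Γ' δ', sequentSize Γ' δ' < sequentSize Γ δ → CKH {x | x ∈ Γ'} δ' → G4CK Γ' δ')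
    (h : CKH {x | x ∈ Γ} δ) : G4CK Γ δ := by
  by_contra hn
  have hδ : 0 < 3 ^ δ.weight := by positivity
  refine hn (of_ckh_of_irreducible ih ⟨?_, ?_, ?_, ?_, ?_, ?_, ?_, ?_, ?_⟩ h)
  · intro hm
    obtain ⟨Γ, rfl⟩ := Multiset.exists_cons_of_mem hm
    exact hn (botL _ _)
  · intro φ ψ hm
    obtain ⟨Γ, rfl⟩ := Multiset.exists_cons_of_mem hm
    refine hn (andL _ _ _ _ (ih _ _ (sequentSize_cons_cons_lt ?_ ?_ _ _)
      (h.cut fun x hx => ?_)))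
    · simp only [Form.weight]; omega
    · simp only [Form.weight]; omega
    · rcases Multiset.mem_cons.1 hx with rfl | hx
      · exact .and_intro (.el (by simp)) (.el (by simp))
      · exact .el (by simp [hx])
  · intro φ ψ hm
    obtain ⟨Γ, rfl⟩ := Multiset.exists_cons_of_mem hm
    have hφ := φ.weight_pos
    have hψ := ψ.weight_pos
    refine hn (orL _ _ _ _ (ih _ _ (sequentSize_cons_lt ?_ _ _) (h.cut fun x hx => ?_))
      (ih _ _ (sequentSize_cons_lt ?_ _ _) (h.cut fun x hx => ?_)))
    · simp only [Form.weight]; omega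
    · rcases Multiset.mem_cons.1 hx with rfl | hx
      · exact .or_inl _ (.el (by simp))
      · exact .el (by simp [hx])
    · simp only [Form.weight]; omega
    · rcases Multiset.mem_cons.1 hx with rfl | hx
      · exact .or_inr _ (.el (by simp))
      · exact .el (by simp [hx])
  · intro φ ψ χ hm
    obtain ⟨Γ, rfl⟩ := Multiset.exists_cons_of_mem hm
    refine hn (andImpL _ _ _ _ _ (ih _ _ (sequentSize_cons_lt ?_ _ _) (h.cut fun x hx => ?_)))
    · simp only [Form.weight]; omega
    · rcases Multiset.mem_cons.1 hx with rfl | hx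
      · have hφψ := CKH.el (Set.mem_insert (φ.and ψ) {x | x ∈ φ.imp (ψ.imp χ) ::ₘ Γ})
        exact .deduction (.mp hφψ.and_right (.mp hφψ.and_left (.el (by simp))))
      · exact .el (by simp [hx])
  · intro φ ψ χ hm
    obtain ⟨Γ, rfl⟩ := Multiset.exists_cons_of_mem hm
    have hφ := φ.weight_pos
    have hψ := ψ.weight_pos
    refine hn (orImpL _ _ _ _ _ (ih _ _ (sequentSize_cons_cons_lt ?_ ?_ _ _)
      (h.cut fun x hx => ?_)))
    · simp only [Form.weight]; omega
    · simp only [Form.weight]; omega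
    · rcases Multiset.mem_cons.1 hx with rfl | hx
      · exact .or_elim (.el (by simp)) (.el (by simp))
      · exact .el (by simp [hx])
  · intro n φ hi hm
    obtain ⟨Γ, rfl⟩ := Multiset.exists_cons_of_mem hm
    obtain ⟨Γ, rfl⟩ := Multiset.exists_cons_of_mem
      ((Multiset.mem_cons.1 hi).resolve_left Form.noConfusion)
    refine hn (pImpL _ _ _ _ (ih _ _ ?_ (h.cut fun x hx => ?_)))
    · rw [Multiset.cons_swap, Multiset.cons_swap _ ((Form.var n).imp φ)]
      exact sequentSize_cons_lt (by simp only [Form.weight]; omega) _ _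
    · simp only [Set.mem_ofPred_eq, Multiset.mem_cons] at hx
      rcases hx with rfl | rfl | hx
      · exact .el (by simp)
      · exact .imp_intro _ (.el (by simp))
      · exact .el (by simp [hx])
  · intro φ ψ χ hm hi
    obtain ⟨Γ, rfl⟩ := Multiset.exists_cons_of_mem hm
    refine hn (impImpL _ _ _ _ _ (ih _ _ ?_ hi.cons_imp_of_cons_imp_imp)
      (ih _ _ (sequentSize_cons_lt ?_ _ _) h.cons_of_cons_imp))
    · have := three_pow_add_lt (a := (ψ.imp χ).weight) (b := (φ.imp ψ).weight)
        (c := ((φ.imp ψ).imp χ).weight)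
        (by simp only [Form.weight]; omega) (by simp only [Form.weight]; omega)
      simp only [sequentSize, antecedentSize_cons]
      omega
    · simp only [Form.weight]; omega
  · intro φ ψ hm hi
    obtain ⟨Γ, rfl⟩ := Multiset.exists_cons_of_mem hm
    rw [boxInv_cons_imp] at hi
    refine hn (boxImpL _ _ _ _ (ih _ _ ?_ hi) (ih _ _ (sequentSize_cons_lt ?_ _ _)
      h.cons_of_cons_imp))
    · have := antecedentSize_boxInv_le Γ
      have := three_pow_lt (a := φ.weight) (c := (φ.box.imp ψ).weight)
        (by simp only [Form.weight]; omega)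
      simp only [sequentSize, antecedentSize_cons]
      omega
    · simp only [Form.weight]; omega
  · intro γ φ ψ hγ hm hi
    obtain ⟨Γ, rfl⟩ := Multiset.exists_cons_of_mem hm
    obtain ⟨Γ, rfl⟩ := Multiset.exists_cons_of_mem
      ((Multiset.mem_cons.1 hγ).resolve_left Form.noConfusion)
    rw [boxInv_cons_imp, boxInv_cons_dia] at hi
    refine hn (diaImpL _ _ _ _ _ (ih _ _ ?_ hi) (ih _ _ (sequentSize_cons_lt ?_ _ _)
      h.cons_of_cons_imp))
    · have := antecedentSize_boxInv_le Γ
      have := three_pow_lt (a := γ.weight) (c := γ.dia.weight) (Nat.lt_succ_self _)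
      have := three_pow_lt (a := φ.weight) (c := (φ.dia.imp ψ).weight)
        (by simp only [Form.weight]; omega)
      simp only [sequentSize, antecedentSize_cons]
      omega
    · simp only [Form.weight]; omega

theorem complete (h : CKH {x | x ∈ Γ} δ) : G4CK Γ δ := by
  induction hn : sequentSize Γ δ using Nat.strong_induction_on generalizing Γ δ with
  | _ n ih =>
    subst hn
    exact of_ckh_step (fun Γ' δ' hlt h' => ih _ hlt h' rfl) h

end G4CK

/-- G4CK is sound and complete with respect to CK: Γ ⇒ δ is provable in
G4CK iff Γ (read as a set) derives δ in the Hilbert calculus CKH. -/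
theorem G4CK_sound_complete :
    ∀ (Γ : Multiset Form) (δ : Form),
      G4CK Γ δ ↔ CKH {φ | φ ∈ Γ} δ := by
  exact fun _ _ => ⟨G4CK.sound, G4CK.complete⟩
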